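/- For every prime p and every multiset J of elements of (ZMod p)^3 with |J| = 5p - 3, J contains a zero-sum sub-multiset of cardinality p or a zero-sum sub-multiset of cardinality 2p. -/

import Mathlib

/-- Functions on finsets spanned by the indicators of `A ⊆ T`, `A` of size at most `d`. -/
def lowDeg (p : ℕ) (ι : Type) [DecidableEq ι] (d : ℕ) :
    Submodule (ZMod p) (Finset ι → ZMod p) :=
  Submodule.span (ZMod p)
    {f | ∃ A : Finset ι, A.card ≤ d ∧ f = fun T => if A ⊆ T then 1 else 0}

section
variable {p : ℕ} {ι : Type} [DecidableEq ι]

lemma lowDeg_ind {d : ℕ} (A : Finset ι) (hA : A.card ≤ d) :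
    (fun T => if A ⊆ T then 1 else 0) ∈ lowDeg p ι d :=
  Submodule.subset_span ⟨A, hA, rfl⟩

lemma lowDeg_one (d : ℕ) : (1 : Finset ι → ZMod p) ∈ lowDeg p ι d := by
  have := lowDeg_ind (p := p) (d := d) (∅ : Finset ι) (by simp)
  convert this using 1
  ext T; simp

lemma lowDeg_mono {d e : ℕ} (h : d ≤ e) : lowDeg p ι d ≤ lowDeg p ι e := by
  apply Submodule.span_mono
  rintro f ⟨A, hA, rfl⟩
  exact ⟨A, hA.trans h, rfl⟩

lemma lowDeg_mul {d e : ℕ} {f g : Finset ι → ZMod p} (hf : f ∈ lowDeg p ι d)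
    (hg : g ∈ lowDeg p ι e) : f * g ∈ lowDeg p ι (d + e) := by
  have h := Submodule.mul_mem_mul hf hg
  unfold lowDeg at h
  rw [Submodule.span_mul_span] at h
  refine Submodule.span_mono ?_ h
  rintro _ ⟨_, ⟨A, hA, rfl⟩, _, ⟨B, hB, rfl⟩, rfl⟩
  refine ⟨A ∪ B, (Finset.card_union_le A B).trans (by omega), ?_⟩
  ext T
  by_cases h1 : A ⊆ T <;> by_cases h2 : B ⊆ T <;> simp [h1, h2, Finset.union_subset_iff]

lemma lowDeg_pow {d : ℕ} {f : Finset ι → ZMod p} (hf : f ∈ lowDeg p ι d) (k : ℕ) :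
    f ^ k ∈ lowDeg p ι (k * d) := by
  induction k with
  | zero => simpa using lowDeg_one 0
  | succ k ih =>
    rw [pow_succ, Nat.succ_mul]
    exact lowDeg_mul ih hf

lemma lowDeg_linear [Fintype ι] (c : ι → ZMod p) :
    (fun T : Finset ι => ∑ i ∈ T, c i) ∈ lowDeg p ι 1 := by
  have : (fun T : Finset ι => ∑ i ∈ T, c i) =
      ∑ i : ι, c i • (fun T : Finset ι => if ({i} : Finset ι) ⊆ T then (1 : ZMod p) else 0) := by
    ext T
    simp
  rw [this]
  exact Submodule.sum_mem _ fun i _ => Submodule.smul_mem _ _ (lowDeg_ind _ (by simp))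

lemma lowDeg_choose [Fintype ι] (k : ℕ) :
    (fun T : Finset ι => ((T.card.choose k : ℕ) : ZMod p)) ∈ lowDeg p ι k := by
  have : (fun T : Finset ι => ((T.card.choose k : ℕ) : ZMod p)) =
      ∑ A ∈ Finset.powersetCard k (Finset.univ : Finset ι),
        (fun T : Finset ι => if A ⊆ T then (1 : ZMod p) else 0) := by
    ext T
    rw [Finset.sum_apply, Finset.sum_boole, ← Finset.card_powersetCard]
    congr 2
    ext A
    simp [Finset.mem_powersetCard, and_comm]
  rw [this]
  exact Submodule.sum_mem _ fun A hA => lowDeg_ind _ (Finset.mem_powersetCard.1 hA).2.le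

lemma alt_sum {d : ℕ} {f : Finset ι → ZMod p} (hf : f ∈ lowDeg p ι d) (S : Finset ι)
    (hS : d < S.card) : ∑ T ∈ S.powerset, (-1) ^ T.card * f T = 0 := by
  unfold lowDeg at hf
  induction hf using Submodule.span_induction with
  | zero => simp
  | add x y _ _ hx hy => simp [mul_add, Finset.sum_add_distrib, hx, hy]
  | smul c x _ hx =>
    simp only [Pi.smul_apply, smul_eq_mul, mul_left_comm _ c, ← Finset.mul_sum, hx, mul_zero]
  | mem x hx =>
    obtain ⟨A, hA, rfl⟩ := hx
    obtain ⟨i, hiS, hiA⟩ := Finset.exists_mem_notMem_of_card_lt_card (hA.trans_lt hS)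
    obtain ⟨S', hiS', rfl⟩ : ∃ S', i ∉ S' ∧ S = insert i S' :=
      ⟨S.erase i, by simp, by simp [Finset.insert_erase hiS]⟩
    rw [Finset.sum_powerset_insert hiS', ← Finset.sum_add_distrib]
    apply Finset.sum_eq_zero
    intro T hT
    have hiT : i ∉ T := fun h => hiS' (Finset.mem_powerset.1 hT h)
    simp only [Finset.card_insert_of_notMem hiT, Finset.subset_insert_iff_of_notMem hiA]
    ring

/-- zero-sum with cardinality divisible by `p` -/
def ZS (a : ι → Fin 3 → ZMod p) (T : Finset ι) : Prop :=
  (T.card : ZMod p) = 0 ∧ ∑ i ∈ T, a i = 0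

open Classical in
lemma key [Fintype ι] (hp : p.Prime) (a : ι → Fin 3 → ZMod p) {e : ℕ} {g : Finset ι → ZMod p}
    (hg : g ∈ lowDeg p ι e) (S : Finset ι) (hS : 4 * (p - 1) + e < S.card) :
    ∑ T ∈ S.powerset, (-1) ^ T.card * (if ZS a T then g T else 0) = 0 := by
  have := Fact.mk hp
  have hl : ∀ c : ι → ZMod p, (1 - (fun T : Finset ι => ∑ i ∈ T, c i) ^ (p - 1)) ∈
      lowDeg p ι (p - 1) := fun c => by
    have := lowDeg_pow (lowDeg_linear c) (p - 1)
    rw [mul_one] at this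
    exact Submodule.sub_mem _ (lowDeg_one _) this
  have h := lowDeg_mul (lowDeg_mul (lowDeg_mul (lowDeg_mul (hl fun _ => 1)
    (hl fun i => a i 0)) (hl fun i => a i 1)) (hl fun i => a i 2)) hg
  have h0 := alt_sum h S (by omega)
  refine Eq.trans ?_ h0
  apply Finset.sum_congr rfl
  intro T _
  congr 1
  have h1 : ∀ x : ZMod p, 1 - x ^ (p - 1) = if x = 0 then 1 else 0 := fun x => by
    split_ifs with hx
    · rw [hx, zero_pow (by have := hp.two_le; omega), sub_zero]
    · rw [ZMod.pow_card_sub_one_eq_one hx, sub_self]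
  have h2 : ZS a T ↔ (∑ i ∈ T, (1 : ZMod p)) = 0 ∧ ∑ i ∈ T, a i 0 = 0 ∧ ∑ i ∈ T, a i 1 = 0 ∧
      ∑ i ∈ T, a i 2 = 0 := by
    unfold ZS
    rw [funext_iff, Fin.forall_fin_succ, Fin.forall_fin_two]
    simp
  simp only [Pi.mul_apply, Pi.sub_apply, Pi.one_apply, Pi.pow_apply, h1]
  by_cases k0 : (∑ i ∈ T, (1 : ZMod p)) = 0 <;> by_cases k1 : ∑ i ∈ T, a i 0 = 0 <;>
    by_cases k2 : ∑ i ∈ T, a i 1 = 0 <;> by_cases k3 : ∑ i ∈ T, a i 2 = 0 <;>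
    simp only [h2, k0, k1, k2, k3, if_true, if_false, and_true, and_false, true_and, false_and,
      mul_one, mul_zero, one_mul, zero_mul]

lemma main_family [Fintype ι] (hp : p.Prime) (a : ι → Fin 3 → ZMod p)
    (hn : Fintype.card ι = 5 * p - 3)
    (n1 : ∀ T : Finset ι, T.card = p → ∑ i ∈ T, a i ≠ 0)
    (n2 : ∀ T : Finset ι, T.card = 2 * p → ∑ i ∈ T, a i ≠ 0) : False := by
  classical
  have := Fact.mk hp
  have hp2 := hp.two_le
  have hZ0 : ZS a (∅ : Finset ι) := by simp [ZS]
  -- possible sizes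
  have sizes : ∀ T : Finset ι, ZS a T → T = ∅ ∨ T.card = 3 * p ∨ T.card = 4 * p := by
    rintro T ⟨h1, h2⟩
    rw [ZMod.natCast_eq_zero_iff] at h1
    obtain ⟨k, hk⟩ := h1
    have hle : T.card ≤ 5 * p - 3 := hn ▸ Finset.card_le_univ T
    have hk5 : k < 5 := by
      by_contra hcon
      have : p * 5 ≤ p * k := Nat.mul_le_mul_left p (by omega)
      omega
    interval_cases k
    · left; exact Finset.card_eq_zero.1 (by omega)
    · exact absurd h2 (n1 T (by omega))
    · exact absurd h2 (n2 T (by omega))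
    · right; left; omega
    · right; right; omega
  have no4 : ∀ T : Finset ι, ZS a T → T.card ≠ 4 * p := by
    intro T hT hc
    have hle : T.card ≤ 5 * p - 3 := hn ▸ Finset.card_le_univ T
    have hp3 : 3 ≤ p := by omega
    have hk := key hp a (lowDeg_one 0) T (by omega)
    have hne : (∅ : Finset ι) ≠ T := by
      rintro rfl
      simp at hc
      omega
    rw [← Finset.sum_subset (s₁ := {∅, T}) (by intro U hU; simp at hU; rcases hU with rfl | rfl <;> simp),
      Finset.sum_pair hne] at hk
    · have he : Even T.card := ⟨2 * p, by omega⟩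
      simp [hZ0, hT, he.neg_one_pow] at hk
      have h2 : ((2 : ℕ) : ZMod p) = 0 := by
        rw [← hk]; norm_num
      rw [ZMod.natCast_eq_zero_iff] at h2
      have := Nat.le_of_dvd (by norm_num) h2
      omega
    · intro U hU hU'
      rw [Finset.mem_powerset] at hU
      simp only [Finset.mem_insert, Finset.mem_singleton, not_or] at hU'
      rw [if_neg, mul_zero]
      intro hZ
      rcases sizes U hZ with h | h | h
      · exact hU'.1 h
      · apply n1 (T \ U) (by rw [Finset.card_sdiff_of_subset hU]; omega)
        have := Finset.sum_sdiff (f := a) hU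
        rw [hZ.2, hT.2, add_zero] at this
        exact this
      · exact hU'.2 (Finset.eq_of_subset_of_card_le hU (by omega))
  by_cases hp3 : p = 3
  · subst hp3
    have all9 : ∀ S : Finset ι, S.card = 9 → ∑ i ∈ S, a i = 0 := by
      intro S hS
      by_contra hcon
      have hk := key hp a (lowDeg_one 0) S (by omega)
      rw [Finset.sum_eq_single ∅] at hk
      · simp [hZ0] at hk
      · intro U hU hU'
        rw [Finset.mem_powerset] at hU
        rw [if_neg, mul_zero]
        intro hZ
        rcases sizes U hZ with h | h | h
        · exact hU' h
        · apply hcon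
          rw [← Finset.eq_of_subset_of_card_le hU (by omega)]
          exact hZ.2
        · exact no4 U hZ h
      · simp
    have alleq : ∀ i j, a i = a j := by
      intro i j
      have hc : 8 ≤ ((Finset.univ : Finset ι) \ {i, j}).card := by
        rw [Finset.card_sdiff_of_subset (Finset.subset_univ _), Finset.card_univ, hn]
        have := Finset.card_le_two (a := i) (b := j)
        omega
      obtain ⟨R, hR, hRc⟩ := Finset.exists_subset_card_eq hc
      have hi : i ∉ R := fun h => by simpa using hR h
      have hj : j ∉ R := fun h => by simpa using hR h
      have e1 := all9 (insert i R) (by rw [Finset.card_insert_of_notMem hi, hRc])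
      have e2 := all9 (insert j R) (by rw [Finset.card_insert_of_notMem hj, hRc])
      rw [Finset.sum_insert hi] at e1
      rw [Finset.sum_insert hj] at e2
      exact add_right_cancel (e1.trans e2.symm)
    obtain ⟨R, hR, hRc⟩ := Finset.exists_subset_card_eq
      (show 3 ≤ (Finset.univ : Finset ι).card by rw [Finset.card_univ, hn]; norm_num)
    apply n1 R hRc
    have hne : R.Nonempty := Finset.card_pos.1 (by omega)
    obtain ⟨i, -⟩ := hne
    rw [Finset.sum_congr rfl (fun j _ => alleq j i), Finset.sum_const, hRc]
    ext k
    simp only [Pi.smul_apply, Pi.zero_apply, nsmul_eq_mul]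
    rw [CharP.cast_eq_zero, zero_mul]
  · have hg : (fun T : Finset ι => ((T.card.choose p : ℕ) : ZMod p)) - (3 : ZMod p) • 1 ∈
        lowDeg p ι p :=
      Submodule.sub_mem _ (lowDeg_choose p) (Submodule.smul_mem _ _ (lowDeg_one p))
    have hk := key hp a hg Finset.univ (by rw [Finset.card_univ, hn]; omega)
    rw [Finset.sum_eq_single ∅] at hk
    · simp [hZ0, Nat.choose_eq_zero_of_lt hp.pos] at hk
      have h3 : ((3 : ℕ) : ZMod p) = 0 := by exact_mod_cast hk
      rw [ZMod.natCast_eq_zero_iff] at h3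
      exact hp3 ((Nat.prime_dvd_prime_iff_eq hp Nat.prime_three).1 h3)
    · intro U _ hU'
      split_ifs with hZ
      · rcases sizes U hZ with h | h | h
        · exact absurd h hU'
        · have hl := Choose.choose_modEq_choose_mod_mul_choose_div_nat (n := 3 * p) (k := p) (p := p)
          rw [Nat.mul_mod_left, Nat.mod_self, Nat.mul_div_cancel _ hp.pos, Nat.div_self hp.pos] at hl
          have hl' := (ZMod.natCast_eq_natCast_iff _ _ _).2 hl
          simp at hl'
          simp [h, hl']
        · exact absurd h (no4 U hZ)
      · simp
    · simp

end

theorem stmt_5 (p : ℕ) (hp : p.Prime) (J : Multiset (Fin 3 → ZMod p))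
    (hJ : Multiset.card J = 5 * p - 3) :
    (∃ T ≤ J, Multiset.card T = p ∧ T.sum = 0) ∨
      (∃ T ≤ J, Multiset.card T = 2 * p ∧ T.sum = 0) := by
  by_contra hcon
  rw [not_or] at hcon
  obtain ⟨h1, h2⟩ := hcon
  induction J using Quotient.inductionOn with
  | h l =>
    have hle : ∀ T : Finset (Fin l.length), T.val.map l.get ≤ (l : Multiset (Fin 3 → ZMod p)) := by
      intro T
      have e : (l : Multiset (Fin 3 → ZMod p)) = (Finset.univ : Finset (Fin l.length)).val.map l.get := by
        simp
      conv_rhs => rw [e]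
      exact Multiset.map_le_map (Finset.val_le_iff.2 (Finset.subset_univ T))
    refine main_family hp l.get (by simpa using hJ) ?_ ?_
    · intro T hT hs
      exact h1 ⟨_, hle T, by simpa using hT, hs⟩
    · intro T hT hs
      exact h2 ⟨_, hle T, by simpa using hT, hs⟩
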